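/- Let F be homogeneous symmetric of degree d with Schur expansion F = sum_{|mu|=d} c_mu s_mu in m variables, all c_mu >= 0, and suppose there exists lambda with c_lambda != 0 such that c_mu != 0 implies mu ⊴ lambda. Then F has saturated Newton polytope, Newton(F) = Newton(s_lambda) = conv(S_m-orbit of lambda), and Newton(F) has the integer decomposition property. -/

import Mathlib

open Finset Pointwise

/-- The Young diagram of a partition with at most `m` parts given as an antitone map. -/
def diagramOf {m : ℕ} (lam : Fin m → ℕ) (h : Antitone lam) : YoungDiagram where
  cells := Finset.univ.biUnion fun i : Fin m =>
    (Finset.range (lam i)).image fun j => ((i : ℕ), j)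
  isLowerSet := by
    rintro ⟨i₁, j₁⟩ ⟨i₂, j₂⟩ ⟨hi, hj⟩ hm
    simp only [Finset.coe_biUnion, Finset.coe_univ, Set.mem_iUnion, Finset.mem_coe,
      Finset.mem_image, Finset.mem_range, Set.mem_univ, true_and, Set.iUnion_true] at hm ⊢
    obtain ⟨i, j, hj', hij⟩ := hm
    have hi1 : (i₁ : ℕ) = (i : ℕ) := ((Prod.mk.injEq _ _ _ _).mp hij).1.symm
    have hj1 : j₁ = j := ((Prod.mk.injEq _ _ _ _).mp hij).2.symm
    have hi2m : i₂ < m := lt_of_le_of_lt (le_of_le_of_eq hi hi1) i.isLt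
    refine ⟨⟨i₂, hi2m⟩, j₂, ?_, rfl⟩
    have : lam i ≤ lam ⟨i₂, hi2m⟩ := h (by simpa [Fin.le_def] using le_of_le_of_eq hi hi1)
    omega

/-- The content of a tableau: the number of cells with entry `e`. -/
def content (μ : YoungDiagram) (T : SemistandardYoungTableau μ) (e : ℕ) : ℕ :=
  (μ.cells.filter fun c => T c.1 c.2 = e).card

/-- The coefficient of `x^α` in the Schur polynomial `s_μ(x_1, …, x_m)`: the number of
semistandard Young tableaux of shape `μ` with entries in `{0, …, m-1}` and content `α`. -/
noncomputable def schurCoeff (m : ℕ) (μ : YoungDiagram) (α : Fin m → ℕ) : ℕ :=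
  Nat.card {T : SemistandardYoungTableau μ // (∀ i j : ℕ, (i, j) ∈ μ → T i j < m) ∧
    ∀ k : Fin m, content μ T (k : ℕ) = α k}

/-- The Schur polynomial, viewed as its coefficient function. -/
noncomputable def schurR (m : ℕ) (μ : YoungDiagram) : (Fin m → ℕ) → ℝ :=
  fun α => (schurCoeff m μ α : ℝ)

/-- The support of a polynomial (given by its coefficient function), as a set of points of `ℝ^m`. -/
def Supp {m : ℕ} (F : (Fin m → ℕ) → ℝ) : Set (Fin m → ℝ) :=
  {x | ∃ α : Fin m → ℕ, F α ≠ 0 ∧ x = fun i => (α i : ℝ)}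

/-- The Newton polytope of a polynomial. -/
def NewtonP {m : ℕ} (F : (Fin m → ℕ) → ℝ) : Set (Fin m → ℝ) :=
  convexHull ℝ (Supp F)

/-- A lattice point of `ℝ^m`. -/
def IsLattice {m : ℕ} (x : Fin m → ℝ) : Prop := ∀ i, ∃ z : ℤ, x i = z

/-- Saturated Newton polytope. -/
def HasSNP {m : ℕ} (F : (Fin m → ℕ) → ℝ) : Prop :=
  NewtonP F ∩ {x | IsLattice x} = Supp F

/-- Integer decomposition property of a subset of `ℝ^m`. -/
def HasIDP {m : ℕ} (P : Set (Fin m → ℝ)) : Prop :=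
  ∀ t : ℕ, 0 < t → ∀ p ∈ (t : ℝ) • P, IsLattice p →
    ∃ v : Fin t → (Fin m → ℝ), (∀ j, v j ∈ P ∧ IsLattice (v j)) ∧ p = ∑ j, v j

/-- `b` dominates `a`: every partial sum of `b` is at least that of `a`. -/
def Dominates {m : ℕ} (a b : Fin m → ℕ) : Prop :=
  ∀ j : Fin m, ∑ i ∈ Finset.univ.filter (· ≤ j), a i ≤ ∑ i ∈ Finset.univ.filter (· ≤ j), b i

/-- The `S_m`-orbit of a point of `ℕ^m`, as a subset of `ℝ^m`. -/
def orbitR {m : ℕ} (lam : Fin m → ℕ) : Set (Fin m → ℝ) :=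
  {x | ∃ σ : Equiv.Perm (Fin m), x = fun i => (lam (σ i) : ℝ)}

/-- Add a box to row `r`. -/
def AddBoxAt {m : ℕ} (ν : Fin m → ℕ) (r : Fin m) : Fin m → ℕ :=
  Function.update ν r (ν r + 1)

/-- `ν'` is obtained from `ν` by adding a box in the northmost row such that the result is
a partition that is at most `β`. -/
def NorthmostStep {m : ℕ} (β ν ν' : Fin m → ℕ) : Prop :=
  ∃ r : Fin m, ν' = AddBoxAt ν r ∧ Antitone ν' ∧ ν' ≤ β ∧
    ∀ r' : Fin m, r' < r → ¬ (Antitone (AddBoxAt ν r') ∧ AddBoxAt ν r' ≤ β)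

namespace Dom

/-- Function-level tableau of shape `lam` with entries `< m`. -/
def IsTab (m : ℕ) (lam : ℕ → ℕ) (T : ℕ → ℕ → ℕ) : Prop :=
  (∀ i j₁ j₂, j₁ ≤ j₂ → j₂ < lam i → T i j₁ ≤ T i j₂) ∧
  (∀ i₁ i₂ j, i₁ < i₂ → j < lam i₂ → T i₁ j < T i₂ j) ∧
  (∀ i j, j < lam i → T i j < m)

/-- Content of a function-level tableau. -/
def cont (m : ℕ) (lam : ℕ → ℕ) (T : ℕ → ℕ → ℕ) (k : ℕ) : ℕ :=
  ∑ i ∈ range m, ((range (lam i)).filter fun j => T i j = k).card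

/-- The inequalities of the permutohedron. -/
def Q (m : ℕ) (lam α : ℕ → ℕ) : Prop :=
  ∑ i ∈ range m, α i = ∑ i ∈ range m, lam i ∧
  ∀ S ⊆ range m, ∑ i ∈ S, α i ≤ ∑ i ∈ range S.card, lam i

lemma peel_sum (lam : ℕ → ℕ) (hl : Antitone lam) (a : ℕ) (ha : a ≤ lam 0) (k : ℕ) :
    ∑ i ∈ range k, ((lam i - a) + min a (lam (i+1))) + a
      = ∑ i ∈ range k, lam i + min a (lam k) := by
  induction k with
  | zero => simp [ha]
  | succ k ih =>
    rw [sum_range_succ, sum_range_succ]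
    have := hl (Nat.le_succ k)
    simp only [Nat.succ_eq_add_one] at this
    omega

lemma exists_tab (m : ℕ) : ∀ (lam α : ℕ → ℕ), Antitone lam → (∀ i, m ≤ i → lam i = 0) →
    Q m lam α → ∃ T, IsTab m lam T ∧ ∀ k < m, cont m lam T k = α k := by
  induction m with
  | zero =>
    intro lam α hl h0 _
    refine ⟨fun _ _ => 0, ⟨?_, ?_, ?_⟩, ?_⟩ <;> intros <;> simp_all
  | succ m ih =>
    intro lam α hl h0 hQ
    obtain ⟨hs, hS⟩ := hQ
    set a := α m with ha_def
    have ha0 : a ≤ lam 0 := by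
      have := hS {m} (by simp)
      simpa using this
    have ham : lam m ≤ a := by
      have := hS (range m) (by simp)
      rw [sum_range_succ, sum_range_succ] at hs
      simp at this
      omega
    obtain ⟨ν, hν⟩ : ∃ ν : ℕ → ℕ, ν = fun i => (lam i - a) + min a (lam (i+1)) := ⟨_, rfl⟩
    have hps : ∀ k, ∑ i ∈ range k, ν i + a = ∑ i ∈ range k, lam i + min a (lam k) := by
      rw [hν]; exact peel_sum lam hl a ha0
    have hνl : ∀ i, ν i ≤ lam i := by
      intro i
      have := hl (Nat.le_succ i)
      simp only [hν, Nat.succ_eq_add_one] at *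
      omega
    have hνg : ∀ i, lam (i+1) ≤ ν i := by
      intro i
      have := hl (Nat.le_succ i)
      simp only [hν, Nat.succ_eq_add_one] at *
      omega
    have hνa : Antitone ν := antitone_nat_of_succ_le fun i => (hνl _).trans (hνg _)
    have hν0 : ∀ i, m ≤ i → ν i = 0 := by
      intro i hi
      have h1 := h0 (i+1) (by omega)
      have h2 := hl hi
      simp only [hν, h1]
      omega
    have hνQ : Q m ν α := by
      constructor
      · have h1 := hps m
        rw [sum_range_succ, sum_range_succ] at hs
        omega
      · intro S hSm
        have h1 := hps S.card
        have h2 := hS S (hSm.trans (by simp))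
        have hm : m ∉ S := fun h => by simpa using hSm h
        have h3 := hS (insert m S) (by
          intro x hx
          rcases Finset.mem_insert.1 hx with rfl | hx
          · simp
          · have := hSm hx
            simp at this ⊢; omega)
        rw [sum_insert hm, card_insert_of_notMem hm, sum_range_succ] at h3
        omega
    obtain ⟨T', ⟨hr, hcs, hb⟩, hcont⟩ := ih ν α hνa hν0 hνQ
    refine ⟨fun i j => if j < ν i then T' i j else m, ⟨?_, ?_, ?_⟩, ?_⟩
    · intro i j₁ j₂ h12 h2
      dsimp only
      split_ifs with h3 h4 h4
      · exact hr i _ _ h12 h4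
      · exact (hb _ _ h3).le
      · omega
      · exact le_rfl
    · intro i₁ i₂ j h12 h2
      have h5 : j < ν i₁ := lt_of_lt_of_le h2 ((hl (by omega : i₁ + 1 ≤ i₂)).trans (hνg _))
      dsimp only
      rw [if_pos h5]
      split_ifs with h4
      · exact hcs _ _ _ h12 h4
      · exact hb _ _ h5
    · intro i j hj
      dsimp only
      split_ifs with h4
      · have := hb _ _ h4; omega
      · omega
    · intro k hk
      rcases Nat.lt_succ_iff_lt_or_eq.1 hk with hk | rfl
      · rw [← hcont k hk, cont, cont, sum_range_succ]
        have key : ∀ i, ((range (lam i)).filter fun j => (if j < ν i then T' i j else m) = k)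
            = (range (ν i)).filter fun j => T' i j = k := by
          intro i
          ext j
          have := hνl i
          simp only [mem_filter, mem_range]
          split_ifs with h
          · constructor
            · rintro ⟨_, h'⟩; exact ⟨h, h'⟩
            · rintro ⟨_, h'⟩; exact ⟨by omega, h'⟩
          · constructor
            · rintro ⟨_, h'⟩; omega
            · rintro ⟨h', _⟩; omega
        simp only [key]
        simp [hν0 m le_rfl]
      · rw [cont]
        have key : ∀ i, (((range (lam i)).filter
            fun j => (if j < ν i then T' i j else k) = k)).card + ν i = lam i := by
          intro i
          have : ((range (lam i)).filter fun j => (if j < ν i then T' i j else k) = k)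
            = range (lam i) \ range (ν i) := by
            ext j
            simp only [mem_filter, mem_range, mem_sdiff]
            split_ifs with h
            · have := hb _ _ h
              constructor
              · rintro ⟨_, h'⟩; omega
              · rintro ⟨_, h'⟩; omega
            · simp [h]
          rw [this, card_sdiff_of_subset (by simpa using hνl i)]
          have := hνl i
          simp
          omega
        have h1 : ∑ i ∈ range (k+1), ((((range (lam i)).filter
            fun j => (if j < ν i then T' i j else k) = k)).card + ν i)
            = ∑ i ∈ range (k+1), lam i := Finset.sum_congr rfl (fun i _ => key i)
        rw [sum_add_distrib] at h1
        have h2 : ∑ i ∈ range (k+1), ν i + a = ∑ i ∈ range (k+1), lam i := by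
          have h3 := hps (k+1)
          rw [h0 (k+1) le_rfl] at h3
          simpa using h3
        omega

lemma tab_sum (m : ℕ) (lam : ℕ → ℕ) (T : ℕ → ℕ → ℕ) (S : Finset ℕ) :
    ∑ k ∈ S, cont m lam T k
      = ((range m).sigma fun i => (range (lam i)).filter fun j => T i j ∈ S).card := by
  rw [card_sigma]
  simp only [cont]
  rw [sum_comm]
  refine sum_congr rfl fun i _ => ?_
  rw [Finset.card_eq_sum_card_fiberwise (f := fun j => T i j) (t := S)]
  · refine sum_congr rfl fun k hk => ?_
    congr 1
    ext j
    simp only [mem_filter, mem_range]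
    constructor
    · rintro ⟨h, rfl⟩; exact ⟨⟨h, hk⟩, rfl⟩
    · rintro ⟨⟨h, _⟩, rfl⟩; exact ⟨h, rfl⟩
  · intro j hj
    simp at hj
    exact hj.2

lemma tab_Q (m : ℕ) (lam : ℕ → ℕ) (hl : Antitone lam) (T : ℕ → ℕ → ℕ)
    (hT : IsTab m lam T) : Q m lam (cont m lam T) := by
  obtain ⟨hr, hcs, hb⟩ := hT
  constructor
  · rw [tab_sum, card_sigma]
    refine sum_congr rfl fun i _ => ?_
    rw [filter_true_of_mem, card_range]
    intro j hj
    simpa using hb i j (by simpa using hj)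
  · intro S _
    rw [tab_sum]
    have : ∑ i ∈ range S.card, lam i = ((range S.card).sigma fun i => range (lam i)).card := by
      simp
    rw [this]
    refine card_le_card_of_injOn
      (fun c => ⟨((range c.1).filter fun i => T i c.2 ∈ S).card, c.2⟩) ?_ ?_
    · rintro ⟨i, j⟩ h
      simp only [coe_sigma, Set.mem_sigma_iff, mem_coe, mem_range, mem_filter, mem_sigma,
        coe_filter, Set.mem_ofPred_eq] at h ⊢
      obtain ⟨_, hj, hTS⟩ := h
      constructor
      · have h1 : ((range (i+1)).filter fun i' => T i' j ∈ S).card ≤ S.card := by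
          refine card_le_card_of_injOn (fun i' => T i' j) ?_ ?_
          · intro x hx; simp at hx; exact hx.2
          · intro x hx y hy hxy
            simp only [coe_filter, mem_range, Set.mem_ofPred_eq] at hx hy
            by_contra hne
            rcases lt_or_gt_of_ne hne with h | h
            · exact absurd hxy (hcs x y j h (lt_of_lt_of_le hj (hl (by omega)))).ne
            · exact absurd hxy (hcs y x j h (lt_of_lt_of_le hj (hl (by omega)))).ne'
        rw [range_add_one, filter_insert, if_pos hTS, card_insert_of_notMem (by simp)] at h1
        exact h1
      · refine lt_of_lt_of_le hj (hl ?_)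
        exact (card_filter_le _ _).trans (by simp)
    · rintro ⟨i, j⟩ h ⟨i', j'⟩ h' heq
      simp only [coe_sigma, Set.mem_sigma_iff, mem_coe, mem_range, mem_filter, mem_sigma,
        coe_filter, Set.mem_ofPred_eq] at h h'
      simp only [Sigma.mk.injEq, heq_eq_eq] at heq
      obtain ⟨h1, rfl⟩ := heq
      have aux : ∀ x y, x < y → T x j ∈ S → ((range x).filter fun i => T i j ∈ S).card
          < ((range y).filter fun i => T i j ∈ S).card := by
        intro x y hxy hx
        refine card_lt_card ⟨?_, ?_⟩
        · intro z hz
          simp at hz ⊢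
          exact ⟨by omega, hz.2⟩
        · intro hsub
          have := hsub (show x ∈ _ by simp [hxy, hx])
          simp at this
      have : i = i' := by
        by_contra hne
        rcases lt_or_gt_of_ne hne with hh | hh
        · exact absurd h1 (aux _ _ hh h.2.2).ne
        · exact absurd h1 (aux _ _ hh h'.2.2).ne'
      rw [this]

lemma split_sum (t : ℕ) (f : ℕ → ℕ) (l : ℕ) :
    ∑ j ∈ range (t * l), f j = ∑ r ∈ range t, ∑ j ∈ range l, f (t * j + r) := by
  induction l with
  | zero => simp
  | succ l ih =>
    rw [Nat.mul_succ, sum_range_add, ih, ← sum_add_distrib]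
    simp only [sum_range_succ]

lemma split_Q (m t : ℕ) (lam α : ℕ → ℕ) (hl : Antitone lam) (h0 : ∀ i, m ≤ i → lam i = 0)
    (hQ : Q m (fun i => t * lam i) α) :
    ∃ v : ℕ → ℕ → ℕ, (∀ r < t, Q m lam (v r)) ∧ ∀ k < m, α k = ∑ r ∈ range t, v r k := by
  obtain ⟨T, ⟨hr, hcs, hb⟩, hc⟩ := exists_tab m (fun i => t * lam i) α
    (fun i j h => Nat.mul_le_mul_left _ (hl h)) (fun i hi => by simp [h0 i hi]) hQ
  refine ⟨fun r => cont m lam (fun i j => T i (t * j + r)), ?_, ?_⟩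
  · intro r hrt
    have aux : ∀ l j, j < l → t * j + r < t * l := by
      intro l j h
      have := Nat.mul_le_mul_left t (show j + 1 ≤ l from h)
      rw [Nat.mul_succ] at this
      omega
    refine tab_Q m lam hl _ ⟨?_, ?_, ?_⟩
    · intro i j₁ j₂ h12 h2
      exact hr _ _ _ (by have := Nat.mul_le_mul_left t h12; omega) (aux _ _ h2)
    · intro i₁ i₂ j h12 h2
      exact hcs _ _ _ h12 (aux _ _ h2)
    · intro i j h
      exact hb _ _ (aux _ _ h)
  · intro k hk
    rw [← hc k hk]
    simp only [cont, card_filter]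
    rw [sum_comm]
    exact sum_congr rfl fun i _ => split_sum t _ _

/-- Extension by zero. -/
def ext {R : Type} [Zero R] {m : ℕ} (a : Fin m → R) (i : ℕ) : R :=
  if h : i < m then a ⟨i, h⟩ else 0

@[simp] lemma ext_val {R : Type} [Zero R] {m : ℕ} (a : Fin m → R) (i : Fin m) :
    ext a (i : ℕ) = a i := by simp [ext]

lemma ext_zero {R : Type} [Zero R] {m : ℕ} (a : Fin m → R) (i : ℕ) (h : m ≤ i) :
    ext a i = 0 := by simp [ext, h]

lemma ext_anti {m : ℕ} (a : Fin m → ℕ) (h : Antitone a) : Antitone (ext a) := by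
  intro i j hij
  by_cases hj : j < m
  · have hi : i < m := by omega
    simp only [ext, hi, hj, dif_pos]
    exact h (by simpa using hij)
  · rw [ext_zero a j (by omega)]; exact Nat.zero_le _

lemma mem_diag {m : ℕ} (lam : Fin m → ℕ) (h : Antitone lam) (i j : ℕ) :
    (i, j) ∈ diagramOf lam h ↔ j < ext lam i := by
  rw [← YoungDiagram.mem_cells]
  simp only [diagramOf, mem_biUnion, mem_univ, true_and, mem_image, mem_range, Prod.mk.injEq]
  constructor
  · rintro ⟨a, b, hb, rfl, rfl⟩
    simpa using hb
  · intro hj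
    by_cases hi : i < m
    · exact ⟨⟨i, hi⟩, j, by simpa [ext, hi] using hj, rfl, rfl⟩
    · simp [ext, hi] at hj

lemma content_eq {m : ℕ} (lam : Fin m → ℕ) (h : Antitone lam)
    (T : SemistandardYoungTableau (diagramOf lam h)) (e : ℕ) :
    content _ T e = cont m (ext lam) (fun i j => T i j) e := by
  rw [content, cont, Finset.card_eq_sum_card_fiberwise (f := Prod.fst) (t := range m)]
  · refine sum_congr rfl fun i _ => ?_
    symm
    refine card_bij (fun j _ => (i, j)) ?_ ?_ ?_
    · intro j hj
      simp only [mem_filter, mem_range, YoungDiagram.mem_cells, mem_diag] at hj ⊢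
      exact ⟨hj, trivial⟩
    · intro a _ b _ hab
      simpa using hab
    · rintro ⟨a, b⟩ hb
      simp only [mem_filter, mem_range, YoungDiagram.mem_cells, mem_diag] at hb
      obtain ⟨⟨h1, h2⟩, rfl⟩ := hb
      exact ⟨b, by simp [h1, h2], rfl⟩
  · rintro ⟨a, b⟩ hb
    simp only [coe_filter, YoungDiagram.mem_cells, mem_diag, Set.mem_ofPred_eq] at hb
    simp only [coe_range, Set.mem_Iio]
    by_contra hlt
    rw [ext_zero lam a (by omega)] at hb
    omega

lemma finite_tab (m : ℕ) (μ : YoungDiagram) (α : Fin m → ℕ) :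
    Finite {T : SemistandardYoungTableau μ // (∀ i j : ℕ, (i, j) ∈ μ → T i j < m) ∧
    ∀ k : Fin m, content μ T (k : ℕ) = α k} := by
  refine Finite.of_injective (β := μ.cells → Fin m)
    (fun T c => ⟨T.1 c.1.1 c.1.2, T.2.1 _ _ (by simpa using c.2)⟩) ?_
  rintro ⟨T, hT⟩ ⟨T', hT'⟩ heq
  simp only [Subtype.mk.injEq]
  ext i j
  by_cases hij : (i, j) ∈ μ
  · have := congrFun heq ⟨(i, j), by simpa using hij⟩
    simpa using this
  · rw [T.zeros hij, T'.zeros hij]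

lemma Q_congr (m : ℕ) (lam α β : ℕ → ℕ) (h : ∀ k < m, α k = β k) (hQ : Q m lam α) :
    Q m lam β := by
  refine ⟨?_, ?_⟩
  · rw [← hQ.1]
    exact sum_congr rfl fun i hi => (h i (by simpa using hi)).symm
  · intro S hS
    refine le_trans (le_of_eq ?_) (hQ.2 S hS)
    exact sum_congr rfl fun i hi => (h i (by simpa using hS hi)).symm

lemma schur_iff {m : ℕ} (lam : Fin m → ℕ) (h : Antitone lam) (α : Fin m → ℕ) :
    schurCoeff m (diagramOf lam h) α ≠ 0 ↔ Q m (ext lam) (ext α) := by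
  have := finite_tab m (diagramOf lam h) α
  rw [schurCoeff, Nat.card_ne_zero, and_iff_left this]
  constructor
  · rintro ⟨T, hT, hc⟩
    have hQ := tab_Q m (ext lam) (ext_anti lam h) (fun i j => T i j) ⟨?_, ?_, ?_⟩
    · refine Q_congr _ _ _ _ ?_ hQ
      intro k hk
      rw [← content_eq lam h]
      have := hc ⟨k, hk⟩
      simpa [ext, hk] using this
    · intro i j₁ j₂ h12 h2
      exact T.row_weak_of_le h12 ((mem_diag lam h _ _).2 h2)
    · intro i₁ i₂ j h12 h2
      exact T.col_strict h12 ((mem_diag lam h _ _).2 h2)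
    · intro i j hj
      exact hT _ _ ((mem_diag lam h _ _).2 hj)
  · intro hQ
    obtain ⟨T, ⟨hr, hcs, hb⟩, hc⟩ := exists_tab m _ _ (ext_anti lam h) (ext_zero lam) hQ
    let T' : SemistandardYoungTableau (diagramOf lam h) :=
      { entry := fun i j => if j < ext lam i then T i j else 0
        row_weak' := by
          intro i j1 j2 h12 h2
          rw [mem_diag] at h2
          rw [if_pos h2, if_pos (h12.trans h2)]
          exact hr _ _ _ h12.le h2
        col_strict' := by
          intro i1 i2 j h12 h2
          rw [mem_diag] at h2
          rw [if_pos h2, if_pos (lt_of_lt_of_le h2 (ext_anti lam h h12.le))]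
          exact hcs _ _ _ h12 h2
        zeros' := by
          intro i j hij
          rw [mem_diag] at hij
          rw [if_neg hij] }
    have hT' : ∀ i j, T' i j = if j < ext lam i then T i j else 0 := fun _ _ => rfl
    refine ⟨T', ?_, ?_⟩
    · intro i j hij
      rw [mem_diag] at hij
      rw [hT', if_pos hij]
      exact hb _ _ hij
    · intro k
      rw [content_eq, ← ext_val α k, ← hc k k.2]
      unfold cont
      refine sum_congr rfl fun i _ => ?_
      congr 1
      refine filter_congr fun j hj => ?_
      dsimp only
      rw [hT', if_pos (by simpa using hj)]

/-- Real version of the inequalities. -/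
def RQ {m : ℕ} (lam : Fin m → ℕ) (x : Fin m → ℝ) : Prop :=
  ∑ i, x i = ∑ i, (lam i : ℝ) ∧
  ∀ S : Finset (Fin m), ∑ i ∈ S, x i ≤ ((∑ i ∈ range S.card, ext lam i : ℕ) : ℝ)

lemma sum_ext {R : Type} [AddCommMonoid R] {m : ℕ} (a : Fin m → R) :
    ∑ i ∈ range m, ext a i = ∑ i, a i := by
  rw [Finset.sum_range]; simp

lemma Q_iff {m : ℕ} (lam α : Fin m → ℕ) :
    Q m (ext lam) (ext α) ↔ RQ lam (fun i => (α i : ℝ)) := by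
  unfold Q RQ
  dsimp only
  rw [sum_ext, sum_ext]
  refine and_congr (by norm_cast) ⟨?_, ?_⟩
  · intro h S
    have := h (S.map Fin.valEmbedding) (by
      intro x hx
      obtain ⟨a, _, rfl⟩ := mem_map.1 hx
      simp)
    rw [sum_map, card_map] at this
    simp only [Fin.valEmbedding_apply, ext_val] at this
    exact_mod_cast this
  · intro h S hS
    have hS' : (univ.filter fun i : Fin m => (i : ℕ) ∈ S).map Fin.valEmbedding = S := by
      ext x
      simp only [mem_map, mem_filter, mem_univ, true_and, Fin.valEmbedding_apply]
      constructor
      · rintro ⟨a, ha, rfl⟩; exact ha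
      · intro hx
        exact ⟨⟨x, by simpa using hS hx⟩, hx, rfl⟩
    have := h (univ.filter fun i : Fin m => (i : ℕ) ∈ S)
    rw [← hS', sum_map, card_map]
    simp only [Fin.valEmbedding_apply, ext_val]
    exact_mod_cast this

lemma Q_self (m : ℕ) (lam : ℕ → ℕ) (hl : Antitone lam) (h0 : ∀ i, m ≤ i → lam i = 0) :
    Q m lam lam := by
  have := tab_Q m lam hl (fun i _ => i) ⟨fun _ _ _ _ _ => le_rfl, fun _ _ _ h _ => h, by
    intro i j hj
    by_contra h
    have h' : m ≤ i := not_lt.1 h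
    rw [h0 i h'] at hj
    omega⟩
  refine Q_congr _ _ _ _ ?_ this
  intro k hk
  simp only [cont, Finset.filter_const]
  rw [Finset.sum_eq_single k]
  · simp
  · intro b _ hb; simp [hb]
  · intro h; simp at h; omega

lemma RQ_orbit {m : ℕ} (lam : Fin m → ℕ) (hl : Antitone lam) (x : Fin m → ℝ)
    (hx : x ∈ orbitR lam) : RQ lam x := by
  obtain ⟨σ, rfl⟩ := hx
  have h := (Q_iff lam lam).1 (Q_self m _ (ext_anti lam hl) (ext_zero lam))
  refine ⟨Equiv.sum_comp σ (fun i => (lam i : ℝ)), fun S => ?_⟩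
  have := h.2 (S.map σ.toEmbedding)
  rw [sum_map, card_map] at this
  exact this

lemma RQ_convex {m : ℕ} (lam : Fin m → ℕ) : Convex ℝ {x | RQ lam x} := by
  intro x hx y hy a b ha hb hab
  have e : ∀ S : Finset (Fin m), ∑ i ∈ S, (a • x + b • y) i
      = a * ∑ i ∈ S, x i + b * ∑ i ∈ S, y i := by
    intro S
    simp [sum_add_distrib, mul_sum]
  refine ⟨?_, fun S => ?_⟩
  · rw [e, hx.1, hy.1, ← add_mul, hab, one_mul]
  · rw [e]
    have h1 := mul_le_mul_of_nonneg_left (hx.2 S) ha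
    have h2 := mul_le_mul_of_nonneg_left (hy.2 S) hb
    refine (add_le_add h1 h2).trans (le_of_eq ?_)
    rw [← add_mul, hab, one_mul]

lemma abel (n : ℕ) (f g : ℕ → ℝ) (hf : ∀ i, i + 1 < n → f (i+1) ≤ f i)
    (hG : ∀ k ≤ n, ∑ i ∈ range k, g i ≤ 0) (h0 : ∑ i ∈ range n, g i = 0) :
    ∑ i ∈ range n, f i * g i ≤ 0 := by
  have := Finset.sum_range_by_parts f g n
  simp only [smul_eq_mul] at this
  rw [this, h0, mul_zero, zero_sub, neg_nonpos]
  refine sum_nonneg fun i hi => ?_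
  simp only [mem_range] at hi
  exact mul_nonneg_of_nonpos_of_nonpos (by linarith [hf i (by omega)]) (hG _ (by omega))

lemma rado {m : ℕ} (lam : Fin m → ℕ) (x : Fin m → ℝ) (hx : RQ lam x) :
    x ∈ convexHull ℝ (orbitR lam) := by
  by_contra hcon
  have hfin : (orbitR lam).Finite := by
    have : orbitR lam = Set.range (fun (σ : Equiv.Perm (Fin m)) => fun i => (lam (σ i) : ℝ)) := by
      ext y
      simp only [orbitR, Set.mem_range, Set.mem_ofPred_eq, eq_comm]
    rw [this]
    exact Set.finite_range _
  obtain ⟨f, u, hfu, hux⟩ := geometric_hahn_banach_closed_point (convex_convexHull ℝ _)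
    (hfin.isClosed_convexHull ℝ) hcon
  set w : Fin m → ℝ := fun i => f (Pi.single i 1) with hw
  have hf : ∀ y : Fin m → ℝ, f y = ∑ i, w i * y i := by
    intro y
    conv_lhs => rw [pi_eq_sum_univ' y]
    rw [map_sum]
    refine sum_congr rfl fun i _ => ?_
    rw [map_smul, smul_eq_mul, mul_comm, hw]
  set σ := Tuple.sort (fun i => - w i) with hσ
  have hmono := Tuple.monotone_sort (fun i => - w i)
  rw [← hσ] at hmono
  have h1 := hfu (fun i => (lam (σ⁻¹ i) : ℝ)) (subset_convexHull ℝ _ ⟨σ⁻¹, rfl⟩)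
  rw [hf, ← Equiv.sum_comp σ] at h1
  rw [hf, ← Equiv.sum_comp σ] at hux
  simp only [Equiv.Perm.inv_def, Equiv.symm_apply_apply] at h1
  have h2 : ∑ i ∈ range m, ext (fun i => w (σ i)) i * ext (fun i => x (σ i) - (lam i : ℝ)) i ≤ 0 := by
    apply abel
    · intro i hi
      have hi' : i < m := by omega
      simp only [ext, hi, hi', dif_pos]
      have := hmono (show (⟨i, hi'⟩ : Fin m) ≤ ⟨i+1, hi⟩ by simp)
      simpa using this
    · intro k hk
      have := hx.2 ((univ : Finset (Fin k)).map ((Fin.castLEEmb hk).trans σ.toEmbedding))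
      rw [sum_map, card_map, card_univ, Fintype.card_fin, Finset.sum_range] at this
      rw [Finset.sum_range]
      have e : ∀ i : Fin k, ext (fun i => x (σ i) - (lam i : ℝ)) (i : ℕ)
          = x (σ (Fin.castLE hk i)) - (ext lam (i : ℕ) : ℕ) := by
        intro i
        have : (i : ℕ) < m := by omega
        simp only [ext, this, dif_pos]
        rfl
      simp only [e, sum_sub_distrib]
      push_cast at this
      exact sub_nonpos.2 this
    · rw [sum_ext, sum_sub_distrib, Equiv.sum_comp σ x, hx.1, sub_self]
  rw [Finset.sum_range] at h2
  simp only [ext_val, mul_sub, sum_sub_distrib] at h2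
  linarith

lemma hull_iff {m : ℕ} (lam : Fin m → ℕ) (hl : Antitone lam) :
    convexHull ℝ (orbitR lam) = {x | RQ lam x} :=
  Set.Subset.antisymm (convexHull_min (fun x hx => RQ_orbit lam hl x hx) (RQ_convex lam))
    (fun x hx => rado lam x hx)

lemma RQ_nonneg {m : ℕ} (lam : Fin m → ℕ) (x : Fin m → ℝ) (hx : RQ lam x) (i : Fin m) :
    0 ≤ x i := by
  have h1 := hx.2 (univ.erase i)
  have h2 := Finset.add_sum_erase univ x (mem_univ i)
  have h3 : ∑ j ∈ range (univ.erase i : Finset (Fin m)).card, ext lam j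
      ≤ ∑ j ∈ range m, ext lam j := by
    refine sum_le_sum_of_subset ?_
    refine range_subset_range.2 ((card_erase_le).trans (by simp))
  rw [sum_ext] at h3
  have h4 : ((∑ j ∈ range (univ.erase i : Finset (Fin m)).card, ext lam j : ℕ) : ℝ)
      ≤ ((∑ j, lam j : ℕ) : ℝ) := by exact_mod_cast h3
  have h5 := hx.1
  push_cast at h4 h1
  linarith

lemma lattice_nat {m : ℕ} (x : Fin m → ℝ) (h0 : ∀ i, 0 ≤ x i) (hx : IsLattice x) :
    ∃ α : Fin m → ℕ, x = fun i => (α i : ℝ) := by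
  have : ∀ i, ∃ n : ℕ, x i = n := by
    intro i
    obtain ⟨z, hz⟩ := hx i
    have hz0 : 0 ≤ z := by
      have := h0 i
      rw [hz] at this
      exact_mod_cast this
    lift z to ℕ using hz0
    exact ⟨z, by simpa using hz⟩
  choose α hα using this
  exact ⟨α, funext hα⟩

lemma dom_prefix {m : ℕ} (μ lam : Fin m → ℕ) (h : Dominates μ lam) (k : ℕ) (hk : k ≤ m) :
    ∑ i ∈ range k, ext μ i ≤ ∑ i ∈ range k, ext lam i := by
  rcases k with _ | k
  · simp
  have hd := h ⟨k, hk⟩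
  have e : ∀ a : Fin m → ℕ, ∑ i ∈ univ.filter (· ≤ (⟨k, hk⟩ : Fin m)), a i
      = ∑ i ∈ range (k+1), ext a i := by
    intro a
    have : (univ.filter (· ≤ (⟨k, hk⟩ : Fin m))).map Fin.valEmbedding = range (k+1) := by
      ext x
      simp only [mem_map, mem_filter, mem_univ, true_and, Fin.valEmbedding_apply, mem_range]
      constructor
      · rintro ⟨a, ha, rfl⟩
        have : (a : ℕ) ≤ k := ha
        omega
      · intro hx
        exact ⟨⟨x, by omega⟩, by simp [Fin.le_def]; omega, rfl⟩
    rw [← this, sum_map]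
    simp
  rwa [e, e] at hd

lemma Q_dom {m : ℕ} (μ lam : Fin m → ℕ) (h : Dominates μ lam) (hs : ∑ k, μ k = ∑ k, lam k)
    (α : ℕ → ℕ) (hQ : Q m (ext μ) α) : Q m (ext lam) α := by
  refine ⟨?_, fun S hS => ?_⟩
  · rw [hQ.1, sum_ext, sum_ext, hs]
  · refine (hQ.2 S hS).trans (dom_prefix μ lam h _ ?_)
    simpa using card_le_card hS

lemma idp {m : ℕ} (lam : Fin m → ℕ) (hl : Antitone lam) : HasIDP {x | RQ lam x} := by
  intro t ht p hp hpl
  obtain ⟨x, hx, rfl⟩ := Set.mem_smul_set.1 hp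
  have hx' : RQ lam x := hx
  have ht' : (0 : ℝ) ≤ t := by positivity
  have hext : ext (fun i => t * lam i) = fun i => t * ext lam i := by
    funext i
    simp only [ext]
    split_ifs <;> simp
  have hRQ : RQ (fun i => t * lam i) ((t : ℝ) • x) := by
    refine ⟨?_, fun S => ?_⟩
    · simp only [Pi.smul_apply, smul_eq_mul, ← mul_sum, hx'.1]
      push_cast
      rw [mul_sum]
    · rw [hext]
      simp only [Pi.smul_apply, smul_eq_mul, ← mul_sum]
      push_cast
      have := mul_le_mul_of_nonneg_left (hx'.2 S) ht'
      push_cast at this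
      exact this
  obtain ⟨α, hα⟩ := lattice_nat _ (RQ_nonneg _ _ hRQ) hpl
  rw [hα] at hRQ ⊢
  rw [← Q_iff, hext] at hRQ
  obtain ⟨v, hv, hsum⟩ := split_Q m t (ext lam) (ext α) (ext_anti lam hl) (ext_zero lam) hRQ
  refine ⟨fun r i => (v r i : ℝ), fun r => ⟨?_, fun i => ⟨v r i, by simp⟩⟩, ?_⟩
  · show RQ lam (fun i : Fin m => ((v r i : ℕ) : ℝ))
    rw [← Q_iff lam (fun i : Fin m => v r i)]
    exact Q_congr _ _ _ _ (fun k hk => by simp [ext, hk]) (hv r r.2)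
  · funext i
    have := hsum i i.2
    rw [ext_val, Finset.sum_range] at this
    rw [this, Finset.sum_apply]
    push_cast
    rfl

end Dom

/-- If `F = ∑_μ c_μ s_μ` is homogeneous of degree `d`, all `c_μ ≥ 0`, and there is a partition
`λ` with `c_λ ≠ 0` dominating all partitions appearing in `F`, then `F` has saturated Newton
polytope, `Newton(F) = Newton(s_λ) = conv(S_m-orbit of λ)`, and `Newton(F)` has the integer
decomposition property. -/
theorem dominated_nonneg_hasSNP_IDP (m d : ℕ) (ι : Type) [Fintype ι]
    (c : ι → ℝ) (hc : ∀ j, 0 ≤ c j)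
    (μ : ι → Fin m → ℕ) (hμ : ∀ j, Antitone (μ j)) (hdeg : ∀ j, (∑ k, μ j k) = d)
    (lam : Fin m → ℕ) (hlam : Antitone lam) (hlamd : (∑ k, lam k) = d)
    (hmem : ∃ j, c j ≠ 0 ∧ μ j = lam)
    (hdom : ∀ j, c j ≠ 0 → Dominates (μ j) lam)
    (F : (Fin m → ℕ) → ℝ)
    (hF : F = fun α => ∑ j, c j * (schurCoeff m (diagramOf (μ j) (hμ j)) α : ℝ)) :
    HasSNP F ∧
    NewtonP F = NewtonP (schurR m (diagramOf lam hlam)) ∧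
    NewtonP F = convexHull ℝ (orbitR lam) ∧
    HasIDP (NewtonP F) := by
  have hsum : ∀ α, F α ≠ 0 ↔ Dom.Q m (Dom.ext lam) (Dom.ext α) := by
    intro α
    have hnn : ∀ j ∈ (univ : Finset ι),
        0 ≤ c j * (schurCoeff m (diagramOf (μ j) (hμ j)) α : ℝ) :=
      fun j _ => mul_nonneg (hc j) (Nat.cast_nonneg _)
    rw [hF]
    dsimp only
    rw [Ne, sum_eq_zero_iff_of_nonneg hnn]
    constructor
    · intro h
      push Not at h
      obtain ⟨j, _, hj⟩ := h
      have h1 : c j ≠ 0 := left_ne_zero_of_mul hj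
      have h2 : schurCoeff m (diagramOf (μ j) (hμ j)) α ≠ 0 := by
        exact_mod_cast right_ne_zero_of_mul hj
      exact Dom.Q_dom (μ j) lam (hdom j h1) (by rw [hdeg, hlamd]) _
        ((Dom.schur_iff _ (hμ j) α).1 h2)
    · intro hQ h
      obtain ⟨j, hj, hjl⟩ := hmem
      have h1 := h j (mem_univ j)
      have h2 : schurCoeff m (diagramOf (μ j) (hμ j)) α ≠ 0 :=
        (Dom.schur_iff _ (hμ j) α).2 (by rw [hjl]; exact hQ)
      exact mul_ne_zero hj (by exact_mod_cast h2) h1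
  have hSupp : Supp F = Supp (schurR m (diagramOf lam hlam)) := by
    ext x
    simp only [Supp, Set.mem_ofPred_eq, hsum, schurR, ← Dom.schur_iff lam hlam, Nat.cast_ne_zero]
  have hSuppQ : ∀ x, x ∈ Supp F ↔ ∃ α : Fin m → ℕ, Dom.RQ lam (fun i => (α i : ℝ)) ∧
      x = fun i => (α i : ℝ) := by
    intro x
    simp only [Supp, Set.mem_ofPred_eq, hsum, Dom.Q_iff]
  have hN : NewtonP F = {x | Dom.RQ lam x} := by
    refine Set.Subset.antisymm (convexHull_min ?_ (Dom.RQ_convex lam)) ?_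
    · intro x hx
      obtain ⟨α, hα, rfl⟩ := (hSuppQ x).1 hx
      exact hα
    · rw [← Dom.hull_iff lam hlam]
      refine convexHull_mono ?_
      intro x hx
      obtain ⟨σ, rfl⟩ := id hx
      exact (hSuppQ _).2 ⟨fun i => lam (σ i), Dom.RQ_orbit lam hlam _ hx, rfl⟩
  refine ⟨?_, ?_, ?_, ?_⟩
  · rw [HasSNP, hN]
    ext x
    rw [hSuppQ]
    constructor
    · rintro ⟨hx, hl⟩
      obtain ⟨α, rfl⟩ := Dom.lattice_nat x (Dom.RQ_nonneg lam x hx) hl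
      exact ⟨α, hx, rfl⟩
    · rintro ⟨α, hα, rfl⟩
      exact ⟨hα, fun i => ⟨α i, by simp⟩⟩
  · rw [NewtonP, NewtonP, hSupp]
  · rw [hN, Dom.hull_iff lam hlam]
  · rw [hN]
    exact Dom.idp lam hlam
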